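/- Let K be a field and Λ a τ-tilting finite finite-dimensional K-algebra. For every torsion class 𝒯 of finite-dimensional right Λ-modules, the pop-stack operators of the finite lattice tors Λ satisfy: (1) pop↓(pop↑(𝒯)) ⊆ 𝒯; (2) pop↑(pop↓(𝒯)) ⊇ 𝒯; (3) pop↓(pop↑(pop↓(𝒯))) = pop↓(𝒯); (4) pop↑(pop↓(pop↑(𝒯))) = pop↑(𝒯). -/

import Mathlib

namespace PaperTors

universe u

variable (K : Type u) [Field K] (Λ : Type u) [Ring Λ] [Algebra K Λ]

/-- The category of finite-dimensional right `Λ`-modules is modeled as bundled left modules over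
the opposite algebra `Λᵐᵒᵖ` (a right `Λ`-module is the same thing as a left `Λᵐᵒᵖ`-module). -/
abbrev RMod := ModuleCat.{u} Λᵐᵒᵖ

/-- `M` is finite-dimensional over `K` (with the `K`-action obtained through the algebra map
`K → Λᵐᵒᵖ`). -/
def IsFinDim (M : RMod Λ) : Prop :=
  letI : Module K M := Module.compHom M (algebraMap K Λᵐᵒᵖ)
  FiniteDimensional K M

/-- `𝒯` is a torsion class of finite-dimensional right `Λ`-modules: a class of modules, closed
under isomorphism, consisting of finite-dimensional modules, containing the zero module, and
closed under quotient modules and under extensions. -/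
structure IsTorsionClass (𝒯 : Set (RMod Λ)) : Prop where
  iso_closed : ∀ M N : RMod Λ, (M ≃ₗ[Λᵐᵒᵖ] N) → M ∈ 𝒯 → N ∈ 𝒯
  finDim : ∀ M ∈ 𝒯, IsFinDim K Λ M
  zero_mem : ∀ M : RMod Λ, Subsingleton M → M ∈ 𝒯
  quot_closed : ∀ (M N : RMod Λ) (f : M →ₗ[Λᵐᵒᵖ] N), Function.Surjective f → M ∈ 𝒯 → N ∈ 𝒯
  ext_closed : ∀ (M : RMod Λ) (A : Submodule Λᵐᵒᵖ M),
    ModuleCat.of Λᵐᵒᵖ A ∈ 𝒯 → ModuleCat.of Λᵐᵒᵖ (M ⧸ A) ∈ 𝒯 → M ∈ 𝒯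

/-- The lattice of torsion classes `tors Λ`, ordered by inclusion. -/
def TorsionClass : Type (u + 1) := {𝒯 : Set (RMod Λ) // IsTorsionClass K Λ 𝒯}

instance : PartialOrder (TorsionClass K Λ) := Subtype.partialOrder _

/-- `y` is the image of `x` under the pop-stack operator: `y` is the meet (the greatest lower
bound) of the set consisting of `x` together with all elements covered by `x`. -/
def IsPopDown {α : Type*} [PartialOrder α] (x y : α) : Prop :=
  IsGLB (insert x {z | z ⋖ x}) y

/-- `y` is the image of `x` under the dual pop-stack operator: `y` is the join (the least upper
bound) of the set consisting of `x` together with all elements covering `x`. -/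
def IsPopUp {α : Type*} [PartialOrder α] (x y : α) : Prop :=
  IsLUB (insert x {z | x ⋖ z}) y

variable {K}

/-- `W_L(𝒯)`: modules `M ∈ 𝒯` such that the kernel of any homomorphism from a module of `𝒯`
to `M` again lies in `𝒯`. -/
def WLower (𝒯 : Set (RMod Λ)) : Set (RMod Λ) :=
  {M | M ∈ 𝒯 ∧ ∀ N : RMod Λ, N ∈ 𝒯 → ∀ f : N →ₗ[Λᵐᵒᵖ] M,
    ModuleCat.of Λᵐᵒᵖ (LinearMap.ker f) ∈ 𝒯}

/-- `𝒟(𝒯)`: the nonzero modules of `W_L(𝒯)` having no proper nonzero submodule belonging to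
`W_L(𝒯)` (the brick labels of the cover relations below `𝒯`). -/
def DSet (𝒯 : Set (RMod Λ)) : Set (RMod Λ) :=
  {M | M ∈ WLower Λ 𝒯 ∧ (∃ m : M, m ≠ 0) ∧
    ∀ N : Submodule Λᵐᵒᵖ M, ModuleCat.of Λᵐᵒᵖ N ∈ WLower Λ 𝒯 → N = ⊥ ∨ N = ⊤}

/-- `𝒯⊥`: the modules admitting no nonzero homomorphism from any module of `𝒯`. -/
def Perp (𝒯 : Set (RMod Λ)) : Set (RMod Λ) :=
  {M | ∀ T : RMod Λ, T ∈ 𝒯 → ∀ f : T →ₗ[Λᵐᵒᵖ] M, f = 0}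

/-- `W_U(𝒯)`: modules `M ∈ 𝒯⊥` such that the cokernel of any homomorphism from `M` to a module
of `𝒯⊥` again lies in `𝒯⊥`. -/
def WUpper (𝒯 : Set (RMod Λ)) : Set (RMod Λ) :=
  {M | M ∈ Perp Λ 𝒯 ∧ ∀ N : RMod Λ, N ∈ Perp Λ 𝒯 → ∀ f : M →ₗ[Λᵐᵒᵖ] N,
    ModuleCat.of Λᵐᵒᵖ (N ⧸ LinearMap.range f) ∈ Perp Λ 𝒯}

/-- `𝒰(𝒯)`: the nonzero modules of `W_U(𝒯)` having no proper nonzero submodule belonging to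
`W_U(𝒯)` (the brick labels of the cover relations above `𝒯`). -/
def USet (𝒯 : Set (RMod Λ)) : Set (RMod Λ) :=
  {M | M ∈ WUpper Λ 𝒯 ∧ (∃ m : M, m ≠ 0) ∧
    ∀ N : Submodule Λᵐᵒᵖ M, ModuleCat.of Λᵐᵒᵖ N ∈ WUpper Λ 𝒯 → N = ⊥ ∨ N = ⊤}

/-- `Filt(𝒞)`: modules admitting a finite filtration by submodules whose successive quotients
are isomorphic to modules in `𝒞`. -/
def FiltSet (𝒞 : Set (RMod Λ)) : Set (RMod Λ) :=
  {M | ∃ (r : ℕ) (c : Fin (r + 1) → Submodule Λᵐᵒᵖ M), Monotone c ∧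
    c 0 = ⊥ ∧ c (Fin.last r) = ⊤ ∧
    ∀ i : Fin r, ∃ C ∈ 𝒞, Nonempty
      ((↥(c i.succ) ⧸ Submodule.comap (c i.succ).subtype (c i.castSucc)) ≃ₗ[Λᵐᵒᵖ] C)}


section LatticePart

set_option linter.unusedSectionVars false

variable {α : Type*} [CompleteLattice α] [Finite α]

/-- Join-semidistributivity. -/
def JSD (α : Type*) [Lattice α] : Prop :=
  ∀ x y z : α, x ⊔ y = x ⊔ z → x ⊔ (y ⊓ z) = x ⊔ y

/-- Meet-semidistributivity. -/
def MSD (α : Type*) [Lattice α] : Prop :=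
  ∀ x y z : α, x ⊓ y = x ⊓ z → x ⊓ (y ⊔ z) = x ⊓ y

theorem JSD.set (hj : JSD α) {c t : α} (hc : c ≤ t) (s : Set α)
    (hs : ∀ z ∈ s, c ⊔ z = t) : c ⊔ sInf (insert t s) = t := by
  have hfs : s.Finite := Set.toFinite s
  induction s, hfs using Set.Finite.induction_on with
  | empty => simpa using hc
  | @insert a s _ _ ih =>
    have h1 := ih (fun z hz => hs z (Set.mem_insert_of_mem _ hz))
    have h2 := hs a (Set.mem_insert _ _)
    rw [Set.insert_comm, sInf_insert, hj _ _ _ (h2.trans h1.symm), h2]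

theorem MSD.set (hm : MSD α) {c t : α} (hc : t ≤ c) (s : Set α)
    (hs : ∀ z ∈ s, c ⊓ z = t) : c ⊓ sSup (insert t s) = t := by
  have hfs : s.Finite := Set.toFinite s
  induction s, hfs using Set.Finite.induction_on with
  | empty => simpa using hc
  | @insert a s _ _ ih =>
    have h1 := ih (fun z hz => hs z (Set.mem_insert_of_mem _ hz))
    have h2 := hs a (Set.mem_insert _ _)
    rw [Set.insert_comm, sSup_insert, hm _ _ _ (h2.trans h1.symm), h2]

theorem exists_cov_up {a b : α} (h : a < b) : ∃ c, a ⋖ c ∧ c ≤ b := by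
  obtain ⟨c, hc, hcb⟩ := exists_covBy_le_of_lt h
  exact ⟨c, hc, hcb⟩

theorem exists_cov_down {a b : α} (h : a < b) : ∃ c, c ⋖ b ∧ a ≤ c := by
  obtain ⟨c, hc, hcb⟩ := exists_le_covBy_of_lt h
  exact ⟨c, hcb, hc⟩

theorem cov_eq_top {a b c : α} (h : a ⋖ b) (h1 : a < c) (h2 : c ≤ b) : c = b :=
  (h.eq_or_eq h1.le h2).resolve_left h1.ne'

theorem cov_eq_bot {a b c : α} (h : a ⋖ b) (h1 : c < b) (h2 : a ≤ c) : c = a :=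
  (h.eq_or_eq h2 h1.le).resolve_right h1.ne

theorem cov_sup {c z x : α} (hc : c ⋖ x) (hz : z ≤ x) (hn : ¬ z ≤ c) : c ⊔ z = x := by
  have h1 : c < c ⊔ z := lt_of_le_of_ne le_sup_left (fun h => hn (by rw [h]; exact le_sup_right))
  exact cov_eq_top hc h1 (sup_le hc.le hz)

theorem cov_inf {a z y : α} (ha : y ⋖ a) (hz : y ≤ z) (hn : ¬ a ≤ z) : a ⊓ z = y := by
  have h1 : a ⊓ z < a := lt_of_le_of_ne inf_le_left (fun h => hn (by rw [← h]; exact inf_le_right))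
  exact cov_eq_bot ha h1 (le_inf ha.le hz)

theorem pop_atom (hj : JSD α) {x y c : α} (hy : IsPopDown x y) (hc : c ⋖ x) :
    ∃ a, y ⋖ a ∧ a ≤ x ∧ ¬ a ≤ c := by
  set m := sInf (insert x {z | z ⋖ x ∧ z ≠ c}) with hmdef
  have h1 : c ⊔ m = x := by
    refine hj.set hc.le _ ?_
    rintro z ⟨hz, hne⟩
    refine cov_sup hc hz.le (fun h => ?_)
    exact hne (cov_eq_bot hz hc.lt h).symm
  have h2 : m ⊓ c ≤ y := by
    refine hy.2 ?_
    rintro z (rfl | hz)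
    · exact inf_le_right.trans hc.le
    · by_cases hzc : z = c
      · exact hzc ▸ inf_le_right
      · exact inf_le_left.trans (sInf_le (Or.inr ⟨hz, hzc⟩))
  have hmc : ¬ m ≤ c := fun h => by
    rw [sup_eq_left.2 h] at h1
    exact hc.lt.ne h1
  have hyc : y ≤ c := hy.1 (Or.inr hc)
  have hym : y ≤ m := le_sInf (by
    rintro z (rfl | hz)
    · exact hy.1 (Or.inl rfl)
    · exact hy.1 (Or.inr hz.1))
  have hlt : y < m := lt_of_le_of_ne hym (fun h => hmc (h ▸ hyc))
  obtain ⟨a, ha, ham⟩ := exists_cov_up hlt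
  refine ⟨a, ha, ham.trans (sInf_le (Or.inl rfl)), fun hac => ?_⟩
  exact ha.lt.not_ge ((le_inf ham hac).trans h2)

theorem pop_two (hj : JSD α) {x y w : α} (hy : IsPopDown x y) (hw : IsPopUp y w) : x ≤ w := by
  by_contra hn
  have hlt : w ⊓ x < x := lt_of_le_of_ne inf_le_right (fun h => hn (by rw [← h]; exact inf_le_left))
  obtain ⟨c, hc, hle⟩ := exists_cov_down hlt
  obtain ⟨a, ha, hax, hac⟩ := pop_atom hj hy hc
  exact hac ((le_inf (hw.1 (Or.inr ha)) hax).trans hle)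

theorem pop_three_aux (hj : JSD α) (hm : MSD α) {x y w c : α} (hy : IsPopDown x y)
    (hw : IsPopUp y w) (hc : c ⋖ w) : y ≤ c := by
  by_contra hn
  have hxw : x ≤ w := pop_two hj hy hw
  have hyx : y ≤ x := hy.1 (Or.inl rfl)
  have hxc : ¬ x ≤ c := fun h => hn (hyx.trans h)
  have hlt : x ⊓ c < x := lt_of_le_of_ne inf_le_left (fun h => hxc (by rw [← h]; exact inf_le_right))
  obtain ⟨d, hd, hle⟩ := exists_cov_down hlt
  have hyd : y ≤ d := hy.1 (Or.inr hd)
  obtain ⟨a, ha, hax, had⟩ := pop_atom hj hy hd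
  have e1 : a ⊓ d = y := cov_inf ha hyd had
  have e2 : a ⊓ sSup (insert y {z | y ⋖ z ∧ z ≠ a}) = y := by
    refine hm.set ha.le _ ?_
    rintro z ⟨hz, hne⟩
    refine cov_inf ha hz.le (fun h => ?_)
    exact hne (cov_eq_top hz ha.lt h).symm
  set m := sSup (insert y {z | y ⋖ z ∧ z ≠ a}) with hmdef
  have e3 : a ⊓ (d ⊔ m) = y := (hm _ _ _ (e1.trans e2.symm)).trans e1
  have hmw : m ≤ w := sSup_le (by
    rintro z (rfl | hz)
    · exact hw.1 (Or.inl rfl)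
    · exact hw.1 (Or.inr hz.1))
  have hdw : d ⊔ m ≤ w := sup_le (hd.le.trans hxw) hmw
  have hdlt : d ⊔ m < w := lt_of_le_of_ne hdw (fun h => by
    rw [h, inf_eq_left.2 (hw.1 (Or.inr ha))] at e3
    exact ha.lt.ne e3.symm)
  obtain ⟨e, he, hde⟩ := exists_cov_down hdlt
  have hae : ¬ a ≤ e := fun h => he.lt.not_ge (hw.2 (by
    rintro z (rfl | hz)
    · exact ha.le.trans h
    · by_cases hza : z = a
      · exact hza ▸ h
      · have hzm : z ≤ m := le_sSup (Or.inr ⟨hz, hza⟩)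
        exact hzm.trans (le_sup_right.trans hde)))
  have f1 : e ⊔ x = w := cov_sup he hxw (fun h => hae (hax.trans h))
  have f2 : e ⊔ c = w := cov_sup he hc.le (fun h => by
    have hce : e = c := cov_eq_bot hc he.lt h
    exact hn (hyd.trans (le_sup_left.trans (hde.trans hce.le))))
  have f3 : e ⊔ (x ⊓ c) = w := (hj _ _ _ (f1.trans f2.symm)).trans f1
  rw [sup_eq_left.2 (hle.trans (le_sup_left.trans hde))] at f3
  exact he.lt.ne f3

open OrderDual in
theorem popUp_dual {x y : α} : IsPopUp x y ↔ IsPopDown (toDual x) (toDual y) := by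
  have h : ∀ z : α, toDual z ⋖ toDual x ↔ x ⋖ z := fun z => toDual_covBy_toDual_iff
  constructor
  · rintro ⟨h1, h2⟩
    refine ⟨fun z hz => h1 (a := ofDual z) ?_, fun z hz => h2 (a := ofDual z) fun t ht => hz (a := toDual t) ?_⟩
    · exact hz.imp id (fun hz => (h z).1 hz)
    · exact ht.imp id (fun hz => (h t).2 hz)
  · rintro ⟨h1, h2⟩
    refine ⟨fun z hz => h1 (a := toDual z) ?_, fun z hz => h2 (a := toDual z) fun t ht => hz (a := ofDual t) ?_⟩
    · exact hz.imp id (fun hz => (h z).2 hz)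
    · exact ht.imp id (fun hz => (h t).1 hz)

open OrderDual in
theorem popDown_dual {x y : α} : IsPopDown x y ↔ IsPopUp (toDual x) (toDual y) := by
  have h : ∀ z : α, toDual x ⋖ toDual z ↔ z ⋖ x := fun z => toDual_covBy_toDual_iff
  constructor
  · rintro ⟨h1, h2⟩
    refine ⟨fun z hz => h1 (a := ofDual z) ?_, fun z hz => h2 (a := ofDual z) fun t ht => hz (a := toDual t) ?_⟩
    · exact hz.imp id (fun hz => (h z).1 hz)
    · exact ht.imp id (fun hz => (h t).2 hz)
  · rintro ⟨h1, h2⟩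
    refine ⟨fun z hz => h1 (a := toDual z) ?_, fun z hz => h2 (a := toDual z) fun t ht => hz (a := ofDual t) ?_⟩
    · exact hz.imp id (fun hz => (h z).2 hz)
    · exact ht.imp id (fun hz => (h t).1 hz)

theorem JSD.dual (hj : JSD α) : MSD αᵒᵈ := hj

theorem MSD.dual (hm : MSD α) : JSD αᵒᵈ := hm

theorem pop_one (hm : MSD α) {x y w : α} (hy : IsPopUp x y) (hw : IsPopDown y w) : w ≤ x :=
  pop_two (α := αᵒᵈ) hm.dual (popUp_dual.1 hy) (popDown_dual.1 hw)

theorem pop_three (hj : JSD α) (hm : MSD α) {x y w v : α} (hy : IsPopDown x y)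
    (hw : IsPopUp y w) (hv : IsPopDown w v) : v = y := by
  refine le_antisymm (pop_one hm hw hv) (hv.2 ?_)
  rintro z (rfl | hz)
  · exact hw.1 (Or.inl rfl)
  · exact pop_three_aux hj hm hy hw hz

theorem pop_four (hj : JSD α) (hm : MSD α) {x y w v : α} (hy : IsPopUp x y)
    (hw : IsPopDown y w) (hv : IsPopUp w v) : v = y :=
  pop_three (α := αᵒᵈ) hm.dual hj.dual (popUp_dual.1 hy) (popDown_dual.1 hw) (popUp_dual.1 hv)

end LatticePart

section ModulePart

set_option linter.style.haveILetI false

variable [FiniteDimensional K Λ]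

theorem finite_op : Module.Finite K Λᵐᵒᵖ :=
  Module.Finite.equiv (MulOpposite.opLinearEquiv K : Λ ≃ₗ[K] Λᵐᵒᵖ)

theorem isFinDim_iff (M : RMod Λ) : IsFinDim K Λ M ↔ Module.Finite Λᵐᵒᵖ M := by
  unfold IsFinDim
  letI : Module K M := Module.compHom M (algebraMap K Λᵐᵒᵖ)
  haveI : IsScalarTower K Λᵐᵒᵖ M := ⟨fun k r m => by
    rw [Algebra.smul_def, mul_smul]; rfl⟩
  haveI : Module.Finite K Λᵐᵒᵖ := finite_op Λ
  constructor
  · intro h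
    haveI : Module.Finite K M := h
    exact Module.Finite.of_restrictScalars_finite K Λᵐᵒᵖ M
  · intro h
    exact Module.Finite.trans Λᵐᵒᵖ M

theorem op_artinian (K : Type u) [Field K] (Λ : Type u) [Ring Λ] [Algebra K Λ]
    [FiniteDimensional K Λ] : IsArtinianRing Λᵐᵒᵖ := by
  haveI : Module.Finite K Λᵐᵒᵖ := finite_op Λ
  exact IsArtinianRing.of_finite K Λᵐᵒᵖ

variable {Λ}

theorem TorsionClass.fin (T : TorsionClass K Λ) {M : RMod Λ} (h : M ∈ T.1) :
    Module.Finite Λᵐᵒᵖ M := (isFinDim_iff (K := K) Λ M).1 (T.2.finDim M h)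

/-- Infimum of a family of torsion classes. -/
def infTors (S : Set (TorsionClass K Λ)) : TorsionClass K Λ :=
  ⟨{M | Module.Finite Λᵐᵒᵖ M ∧ ∀ T ∈ S, M ∈ T.1},
   { iso_closed := fun M N e h => ⟨haveI := h.1; Module.Finite.equiv e,
        fun T hT => T.2.iso_closed M N e (h.2 T hT)⟩
     finDim := fun M h => (isFinDim_iff Λ M).2 h.1
     zero_mem := fun M h => ⟨inferInstance, fun T _ => T.2.zero_mem M h⟩
     quot_closed := fun M N f hf h => ⟨haveI := h.1; Module.Finite.of_surjective f hf,
        fun T hT => T.2.quot_closed M N f hf (h.2 T hT)⟩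
     ext_closed := fun M A h1 h2 => ⟨haveI := h1.1; haveI := h2.1;
          Module.Finite.of_submodule_quotient A,
        fun T hT => T.2.ext_closed M A (h1.2 T hT) (h2.2 T hT)⟩ }⟩

noncomputable instance : InfSet (TorsionClass K Λ) := ⟨infTors⟩

noncomputable instance torsLattice : CompleteLattice (TorsionClass K Λ) :=
  completeLatticeOfInf _ (fun S => ⟨fun T hT _ hM => hM.2 T hT,
    fun T hT => show T.1 ⊆ (infTors S).1 from
      fun M hM => ⟨T.fin hM, fun T' hT' => hT hT' hM⟩⟩)

theorem mem_inf {X Y : TorsionClass K Λ} {M : RMod Λ} :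
    M ∈ (X ⊓ Y).1 ↔ M ∈ X.1 ∧ M ∈ Y.1 := by
  constructor
  · intro h
    exact ⟨(inf_le_left : X ⊓ Y ≤ X) h, (inf_le_right : X ⊓ Y ≤ Y) h⟩
  · rintro ⟨h1, h2⟩
    have hle : infTors {X, Y} ≤ X ⊓ Y := le_inf
      (fun N hN => hN.2 X (by simp)) (fun N hN => hN.2 Y (by simp))
    refine hle ⟨X.fin h1, ?_⟩
    rintro T (rfl | rfl)
    · exact h1
    · exact h2

/-- Finitely generated modules all of whose nonzero quotients have a nonzero submodule in
`X` or `Y`. -/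
def supTors (X Y : TorsionClass K Λ) : TorsionClass K Λ :=
  ⟨{M | Module.Finite Λᵐᵒᵖ M ∧ ∀ (Q : RMod Λ) (f : M →ₗ[Λᵐᵒᵖ] Q), Function.Surjective f →
      Nontrivial Q → ∃ N : Submodule Λᵐᵒᵖ Q, N ≠ ⊥ ∧
        (ModuleCat.of Λᵐᵒᵖ N ∈ X.1 ∨ ModuleCat.of Λᵐᵒᵖ N ∈ Y.1)},
   { iso_closed := fun M N e h => ⟨haveI := h.1; Module.Finite.equiv e,
        fun Q f hf hQ => h.2 Q (f ∘ₗ e.toLinearMap) (hf.comp e.surjective) hQ⟩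
     finDim := fun M h => (isFinDim_iff Λ M).2 h.1
     zero_mem := fun M h => ⟨inferInstance, fun Q f hf hQ =>
       absurd hf.subsingleton (not_subsingleton Q)⟩
     quot_closed := fun M N f hf h => ⟨haveI := h.1; Module.Finite.of_surjective f hf,
        fun Q g hg hQ => h.2 Q (g ∘ₗ f) (hg.comp hf) hQ⟩
     ext_closed := fun M A h1 h2 => ⟨haveI := h1.1; haveI := h2.1;
          Module.Finite.of_submodule_quotient A, fun Q f hf hQ => by
        by_cases hA : A ≤ LinearMap.ker f
        · refine h2.2 Q (A.liftQ f hA) (fun q => ?_) hQ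
          obtain ⟨m, rfl⟩ := hf q
          exact ⟨A.mkQ m, by simp⟩
        · have hnt : Nontrivial (A.map f) := by
            rw [Submodule.nontrivial_iff_ne_bot]
            intro h
            exact hA (LinearMap.le_ker_iff_map.2 h)
          obtain ⟨N, hN, hNX⟩ := h1.2 (ModuleCat.of Λᵐᵒᵖ (A.map f)) (f.submoduleMap A)
            (f.submoduleMap_surjective A) hnt
          let N' : Submodule Λᵐᵒᵖ (A.map f) := N
          let e : N' ≃ₗ[Λᵐᵒᵖ] N'.map (A.map f).subtype :=
            Submodule.equivMapOfInjective (A.map f).subtype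
              (Submodule.injective_subtype _) N'
          refine ⟨N'.map (A.map f).subtype, ?_, ?_⟩
          · intro h
            apply hN
            have hz : N' = ⊥ := Submodule.map_injective_of_injective
              (Submodule.injective_subtype (A.map f)) (by rw [h, Submodule.map_bot])
            exact hz
          · exact hNX.imp (fun h => X.2.iso_closed _ _ e h) (fun h => Y.2.iso_closed _ _ e h)⟩ }⟩

theorem le_supTors (X Y : TorsionClass K Λ) : X ⊔ Y ≤ supTors X Y := by
  refine sup_le (fun M hM => ⟨X.fin hM, fun Q f hf hQ => ?_⟩)
    (fun M hM => ⟨Y.fin hM, fun Q f hf hQ => ?_⟩)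
  · refine ⟨⊤, top_ne_bot, Or.inl ?_⟩
    exact X.2.iso_closed _ _ (Submodule.topEquiv (R := Λᵐᵒᵖ) (M := Q)).symm
      (X.2.quot_closed M Q f hf hM)
  · refine ⟨⊤, top_ne_bot, Or.inr ?_⟩
    exact Y.2.iso_closed _ _ (Submodule.topEquiv (R := Λᵐᵒᵖ) (M := Q)).symm
      (Y.2.quot_closed M Q f hf hM)

theorem exists_sub {X Y : TorsionClass K Λ} {M : RMod Λ} (hM : M ∈ (X ⊔ Y).1)
    (hn : Nontrivial M) : ∃ N : Submodule Λᵐᵒᵖ M, N ≠ ⊥ ∧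
        (ModuleCat.of Λᵐᵒᵖ N ∈ X.1 ∨ ModuleCat.of Λᵐᵒᵖ N ∈ Y.1) :=
  (le_supTors X Y hM).2 M LinearMap.id Function.surjective_id hn

theorem msd_aux {X Y Z : TorsionClass K Λ} (h : X ⊓ Y = X ⊓ Z) (l : ℕ∞) :
    ∀ M : RMod Λ, Module.length Λᵐᵒᵖ M = l → M ∈ X.1 → M ∈ (Y ⊔ Z).1 → M ∈ (X ⊓ Y).1 := by
  induction l using WellFoundedLT.induction with
  | ind l ih =>
    intro M hl hX hYZ
    haveI := op_artinian K Λ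
    haveI := X.fin hX
    rcases subsingleton_or_nontrivial M with hs | hn
    · exact (X ⊓ Y).2.zero_mem M hs
    obtain ⟨N, hN, hNYZ⟩ := exists_sub hYZ hn
    have hq : ModuleCat.of Λᵐᵒᵖ (M ⧸ N) ∈ (X ⊓ Y).1 :=
      ih _ (by rw [← hl]; exact Submodule.length_quotient_lt N hN) _ rfl
        (X.2.quot_closed _ _ N.mkQ N.mkQ_surjective hX)
        ((Y ⊔ Z).2.quot_closed _ _ N.mkQ N.mkQ_surjective hYZ)
    rcases hNYZ with hNY | hNZ
    · exact mem_inf.2 ⟨hX, Y.2.ext_closed M N hNY (mem_inf.1 hq).2⟩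
    · rw [h] at hq ⊢
      exact mem_inf.2 ⟨hX, Z.2.ext_closed M N hNZ (mem_inf.1 hq).2⟩

theorem tors_msd : MSD (TorsionClass K Λ) := by
  intro X Y Z h
  refine le_antisymm (fun M hM => ?_) (inf_le_inf_left _ le_sup_left)
  exact msd_aux h _ M rfl (mem_inf.1 hM).1 (mem_inf.1 hM).2

theorem exists_torsion (X : TorsionClass K Λ) (M : RMod Λ) [Module.Finite Λᵐᵒᵖ M] :
    ∃ t : Submodule Λᵐᵒᵖ M, ModuleCat.of Λᵐᵒᵖ t ∈ X.1 ∧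
      ModuleCat.of Λᵐᵒᵖ (M ⧸ t) ∈ Perp Λ X.1 := by
  haveI := op_artinian K Λ
  obtain ⟨t, ht, hmax⟩ := set_has_maximal_iff_noetherian.2
    (inferInstance : IsNoetherian Λᵐᵒᵖ M) {t | ModuleCat.of Λᵐᵒᵖ t ∈ X.1}
    ⟨⊥, X.2.zero_mem _ (inferInstanceAs (Subsingleton (⊥ : Submodule Λᵐᵒᵖ M)))⟩
  refine ⟨t, ht, fun N hN f => ?_⟩
  let f' : N →ₗ[Λᵐᵒᵖ] M ⧸ t := f
  let s : Submodule Λᵐᵒᵖ M := (LinearMap.range f').comap t.mkQ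
  have hts : t ≤ s := fun x hx => by
    have : t.mkQ x = 0 := by simpa using hx
    change t.mkQ x ∈ LinearMap.range f'
    rw [this]; exact zero_mem _
  let g : s →ₗ[Λᵐᵒᵖ] LinearMap.range f' :=
    (t.mkQ ∘ₗ s.subtype).codRestrict _ (fun x => x.2)
  have hg : Function.Surjective g := by
    rintro ⟨y, hy⟩
    obtain ⟨x, rfl⟩ := t.mkQ_surjective y
    exact ⟨⟨x, hy⟩, rfl⟩
  have hk : LinearMap.ker g = t.comap s.subtype := by
    have h1 : LinearMap.ker g = LinearMap.ker (t.mkQ ∘ₗ s.subtype) :=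
      LinearMap.ker_codRestrict _ _ _
    rw [h1, LinearMap.ker_comp, Submodule.ker_mkQ]
  have hs : ModuleCat.of Λᵐᵒᵖ s ∈ X.1 := by
    refine X.2.ext_closed (ModuleCat.of Λᵐᵒᵖ s) (LinearMap.ker g) ?_ ?_
    · rw [hk]
      exact X.2.iso_closed (ModuleCat.of Λᵐᵒᵖ t) _
        (Submodule.comapSubtypeEquivOfLe hts).symm ht
    · refine X.2.iso_closed (ModuleCat.of Λᵐᵒᵖ (LinearMap.range f')) _
        (g.quotKerEquivOfSurjective hg).symm ?_
      exact X.2.quot_closed N _ f'.rangeRestrict f'.surjective_rangeRestrict hN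
  have hst : s = t := by
    by_contra hne
    exact hmax s hs (lt_of_le_of_ne hts (Ne.symm hne))
  have : f' = 0 := by
    ext n
    obtain ⟨x, hx⟩ := t.mkQ_surjective (f' n)
    have hxs : x ∈ s := by
      change t.mkQ x ∈ LinearMap.range f'
      rw [hx]; exact ⟨n, rfl⟩
    rw [hst] at hxs
    rw [← hx]
    simpa using hxs
  exact this

theorem perp_sub {S : Set (RMod Λ)} {M : RMod Λ} (h : M ∈ Perp Λ S) (N : Submodule Λᵐᵒᵖ M) :
    ModuleCat.of Λᵐᵒᵖ N ∈ Perp Λ S := fun T hT f => by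
  let f' : T →ₗ[Λᵐᵒᵖ] N := f
  have h0 := h T hT (N.subtype ∘ₗ f')
  have : f' = 0 := by
    ext x
    exact LinearMap.congr_fun h0 x
  exact this

theorem perp_ext {S : Set (RMod Λ)} {M : RMod Λ} (N : Submodule Λᵐᵒᵖ M)
    (h1 : ModuleCat.of Λᵐᵒᵖ N ∈ Perp Λ S) (h2 : ModuleCat.of Λᵐᵒᵖ (M ⧸ N) ∈ Perp Λ S) :
    M ∈ Perp Λ S := fun T hT f => by
  have h0 : N.mkQ ∘ₗ f = 0 := h2 T hT (N.mkQ ∘ₗ f)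
  have hf : ∀ x, f x ∈ N := fun x => by
    have := LinearMap.congr_fun h0 x
    simpa using this
  have h3 : f.codRestrict N hf = 0 := h1 T hT (f.codRestrict N hf)
  ext x
  exact congrArg Subtype.val (LinearMap.congr_fun h3 x)

theorem perp_anti {S S' : Set (RMod Λ)} (h : S ⊆ S') {M : RMod Λ} (hM : M ∈ Perp Λ S') :
    M ∈ Perp Λ S := fun T hT f => hM T (h hT) f

theorem perp_self {S : Set (RMod Λ)} {M : RMod Λ} (h : M ∈ Perp Λ S) (hM : M ∈ S) :
    Subsingleton M := by
  have := h M hM LinearMap.id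
  refine ⟨fun x y => ?_⟩
  have hx := LinearMap.congr_fun this x
  have hy := LinearMap.congr_fun this y
  simp at hx hy
  rw [hx, hy]

theorem perp_sup {X Y : TorsionClass K Λ} {M : RMod Λ} (hX : M ∈ Perp Λ X.1)
    (hY : M ∈ Perp Λ Y.1) : M ∈ Perp Λ (X ⊔ Y).1 := fun T hT f => by
  by_contra hne
  have hnt : Nontrivial (LinearMap.range f) := by
    rw [Submodule.nontrivial_iff_ne_bot]
    exact fun h => hne (LinearMap.range_eq_bot.1 h)
  have hr : ModuleCat.of Λᵐᵒᵖ (LinearMap.range f) ∈ (X ⊔ Y).1 :=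
    (X ⊔ Y).2.quot_closed T _ f.rangeRestrict f.surjective_rangeRestrict hT
  obtain ⟨N, hN, hNXY⟩ := exists_sub hr hnt
  apply hN
  have key : Subsingleton N := by
    rcases hNXY with h | h
    · exact perp_self (perp_sub (perp_sub hX (LinearMap.range f)) N) h
    · exact perp_self (perp_sub (perp_sub hY (LinearMap.range f)) N) h
  exact Submodule.subsingleton_iff_eq_bot.1 key

theorem exists_quot (Y : TorsionClass K Λ) (M : RMod Λ) [Module.Finite Λᵐᵒᵖ M] (h : M ∉ Y.1) :
    ∃ t : Submodule Λᵐᵒᵖ M, t ≠ ⊤ ∧ ModuleCat.of Λᵐᵒᵖ (M ⧸ t) ∈ Perp Λ Y.1 := by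
  obtain ⟨t, ht, hp⟩ := exists_torsion Y M
  refine ⟨t, ?_, hp⟩
  rintro rfl
  exact h (Y.2.iso_closed _ _ (Submodule.topEquiv (R := Λᵐᵒᵖ) (M := M)) ht)

theorem jsd_aux {X Y Z : TorsionClass K Λ} (h : X ⊔ Y = X ⊔ Z) (l : ℕ∞) :
    ∀ M : RMod Λ, Module.Finite Λᵐᵒᵖ M → Module.length Λᵐᵒᵖ M = l → M ∈ Perp Λ X.1 →
      M ∈ Perp Λ (Y ⊓ Z).1 → M ∈ Perp Λ (X ⊔ Y).1 := by
  induction l using WellFoundedLT.induction with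
  | ind l ih =>
    intro M hfin hl hX hYZ
    haveI := op_artinian K Λ
    rcases subsingleton_or_nontrivial M with hs | hn
    · intro T hT f
      ext x
      exact Subsingleton.elim _ _
    have hnot : M ∉ Y.1 ∨ M ∉ Z.1 := by
      by_contra hc
      push Not at hc
      exact not_subsingleton M (perp_self hYZ (mem_inf.2 hc))
    have step : ∀ t : Submodule Λᵐᵒᵖ M, t ≠ ⊤ → ModuleCat.of Λᵐᵒᵖ t ∈ Perp Λ (X ⊔ Y).1 :=
      fun t ht => ih _ (by rw [← hl]; exact Submodule.length_lt ht) (ModuleCat.of Λᵐᵒᵖ t)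
        (inferInstanceAs (Module.Finite Λᵐᵒᵖ t)) rfl (perp_sub hX t) (perp_sub hYZ t)
    rcases hnot with hY | hZ
    · obtain ⟨t, ht, hp⟩ := exists_quot Y M hY
      exact perp_sup hX (perp_ext t (perp_anti (le_sup_right : Y ≤ X ⊔ Y) (step t ht)) hp)
    · obtain ⟨t, ht, hp⟩ := exists_quot Z M hZ
      rw [h] at step ⊢
      exact perp_sup hX (perp_ext t (perp_anti (le_sup_right : Z ≤ X ⊔ Z) (step t ht)) hp)

theorem tors_jsd : JSD (TorsionClass K Λ) := by
  intro X Y Z h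
  refine le_antisymm (sup_le_sup_left inf_le_left _) (fun M hM => ?_)
  haveI := (X ⊔ Y).fin hM
  by_contra hn
  obtain ⟨t, ht, hp⟩ := exists_quot (X ⊔ (Y ⊓ Z)) M hn
  have h1 : ModuleCat.of Λᵐᵒᵖ (M ⧸ t) ∈ Perp Λ (X ⊔ Y).1 :=
    jsd_aux h _ _ (inferInstanceAs (Module.Finite Λᵐᵒᵖ (M ⧸ t))) rfl
      (perp_anti (le_sup_left : X ≤ X ⊔ (Y ⊓ Z)) hp)
      (perp_anti (le_sup_right : Y ⊓ Z ≤ X ⊔ (Y ⊓ Z)) hp)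
  have h2 : Subsingleton (M ⧸ t) :=
    perp_self h1 ((X ⊔ Y).2.quot_closed M _ t.mkQ t.mkQ_surjective hM)
  exact ht (Submodule.Quotient.subsingleton_iff.1 h2)

end ModulePart

/-- Let `Λ` be a τ-tilting finite finite-dimensional `K`-algebra.  For every
torsion class `𝒯`: (1) `pop↓(pop↑(𝒯)) ⊆ 𝒯`; (2) `pop↑(pop↓(𝒯)) ⊇ 𝒯`;
(3) `pop↓(pop↑(pop↓(𝒯))) = pop↓(𝒯)`; (4) `pop↑(pop↓(pop↑(𝒯))) = pop↑(𝒯)`. -/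
theorem stmt4 [FiniteDimensional K Λ] (hfin : Finite (TorsionClass K Λ))
    (T : TorsionClass K Λ) :
    (∀ T₁ T₂ : TorsionClass K Λ, IsPopUp T T₁ → IsPopDown T₁ T₂ → T₂ ≤ T) ∧
    (∀ T₁ T₂ : TorsionClass K Λ, IsPopDown T T₁ → IsPopUp T₁ T₂ → T ≤ T₂) ∧
    (∀ T₁ T₂ T₃ : TorsionClass K Λ,
      IsPopDown T T₁ → IsPopUp T₁ T₂ → IsPopDown T₂ T₃ → T₃ = T₁) ∧
    (∀ T₁ T₂ T₃ : TorsionClass K Λ,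
      IsPopUp T T₁ → IsPopDown T₁ T₂ → IsPopUp T₂ T₃ → T₃ = T₁) := by
  haveI := hfin
  exact ⟨fun _ _ h1 h2 => pop_one tors_msd h1 h2, fun _ _ h1 h2 => pop_two tors_jsd h1 h2,
    fun _ _ _ h1 h2 h3 => pop_three tors_jsd tors_msd h1 h2 h3,
    fun _ _ _ h1 h2 h3 => pop_four tors_jsd tors_msd h1 h2 h3⟩

end PaperTors
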